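/- Consider the physical fractional Brownian motion model with Hurst parameter H ∈ (1/2,1), noise intensity σ > 0, scale-separation parameter ε > 0 and fixed horizon T > 0. There exists a constant C > 0, depending only on H, T and σ, such that for every ε > 0 and every N ∈ ℕ, with δ = T/N, the estimator satisfies (E[(σ̂²_{ε,δ} − σ²)²])^{1/2} ≤ C((ε/δ)^{2H} + (ε/δ)^{H} + δ^{1/2}). -/

import Mathlib

open MeasureTheory ProbabilityTheory Filter Matrix Topology

noncomputable section

/-- Covariance function of two-sided fractional Brownian motion with Hurst parameter `H`. -/
def fbmCov (H s t : ℝ) : ℝ :=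
  (|s| ^ (2 * H) + |t| ^ (2 * H) - |s - t| ^ (2 * H)) / 2

/-- `B` is a two-sided fractional Brownian motion with Hurst parameter `H`:
a.s. continuous paths, `B 0 = 0`, and all finite-dimensional marginals are centered
Gaussian with covariance `fbmCov H`. -/
structure IsTwoSidedFBM {Ω : Type*} [MeasureSpace Ω] (H : ℝ) (B : ℝ → Ω → ℝ) : Prop where
  meas : ∀ t, Measurable (B t)
  cont : ∀ᵐ ω : Ω, Continuous fun t => B t ω
  zero : ∀ᵐ ω : Ω, B 0 ω = 0
  gaussian : ∀ (n : ℕ) (t a : Fin n → ℝ),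
    Measure.map (fun ω => ∑ i, a i * B (t i) ω) (ℙ : Measure Ω)
      = gaussianReal 0 (∑ i, ∑ j, a i * a j * fbmCov H (t i) (t j)).toNNReal

/-- The stationary fractional Ornstein–Uhlenbeck process
`Y^ε_t = (σ/ε^H)(B^H_t − (1/ε)∫_{−∞}^t e^{−(t−s)/ε} B^H_s ds)`. -/
def fracOU {Ω : Type*} [MeasureSpace Ω] (H σ ε : ℝ) (B : ℝ → Ω → ℝ) (t : ℝ) (ω : Ω) : ℝ :=
  (σ / ε ^ H) * (B t ω - (1 / ε) * ∫ s in Set.Iic t, Real.exp (-(t - s) / ε) * B s ω)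

/-- The slow component `X^ε_t = ε^{H−1} ∫_0^t Y^ε_s ds` of the physical fractional
Brownian motion model. -/
def slowX {Ω : Type*} [MeasureSpace Ω] (H σ ε : ℝ) (B : ℝ → Ω → ℝ) (t : ℝ) (ω : Ω) : ℝ :=
  ε ^ (H - 1) * ∫ s in (0 : ℝ)..t, fracOU H σ ε B s ω

/-- Covariance matrix of the increments, over a grid of mesh `δ`, of fractional Brownian
motion with Hurst parameter `H`. -/
def SigmaH (H δ : ℝ) (N : ℕ) : Matrix (Fin N) (Fin N) ℝ := fun i j =>
  δ ^ (2 * H) / 2 *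
    (|(i : ℝ) - (j : ℝ) + 1| ^ (2 * H) + |(i : ℝ) - (j : ℝ) - 1| ^ (2 * H)
      - 2 * |(i : ℝ) - (j : ℝ)| ^ (2 * H))

/-- Vector of increments of the slow component over the grid of mesh `δ`. -/
def incVec {Ω : Type*} [MeasureSpace Ω] (H σ ε δ : ℝ) (B : ℝ → Ω → ℝ) (N : ℕ) (ω : Ω) :
    Fin N → ℝ := fun k =>
  slowX H σ ε B (((k : ℕ) + 1 : ℝ) * δ) ω - slowX H σ ε B ((k : ℕ) * δ) ω

/-- The maximum-likelihood-type estimator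
`σ̂²_{ε,δ} = (1/N) Vᵀ (Σ^H_{δ,N})⁻¹ V`. -/
def sigmaHat2 {Ω : Type*} [MeasureSpace Ω] (H σ ε δ : ℝ) (B : ℝ → Ω → ℝ) (N : ℕ) (ω : Ω) : ℝ :=
  (1 / (N : ℝ)) * (incVec H σ ε δ B N ω ⬝ᵥ ((SigmaH H δ N)⁻¹ *ᵥ incVec H σ ε δ B N ω))


lemma integral_pow_four_gaussianReal (v : NNReal) :
    ∫ x, x ^ 4 ∂(gaussianReal 0 v) = 3 * (v : ℝ) ^ 2 := by
  have h := iteratedDeriv_mgf_zero (X := id) (μ := gaussianReal 0 v)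
    (by rw [integrableExpSet_id_gaussianReal]; simp) 4
  have hstep : ∀ p p' : ℝ → ℝ, (∀ t, HasDerivAt p (p' t) t) →
      deriv (fun t => p t * Real.exp (v * t ^ 2 / 2))
        = fun t => (p' t + p t * (v * t)) * Real.exp (v * t ^ 2 / 2) := by
    intro p p' hp
    ext t
    have h1 : HasDerivAt (fun t : ℝ => (v : ℝ) * t ^ 2 / 2) (v * t) t := by
      have := (((hasDerivAt_id t).pow 2).const_mul (v : ℝ)).div_const 2
      refine this.congr_deriv ?_
      simp; ring
    rw [((hp t).fun_mul h1.exp).deriv]; ring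
  have e1 := hstep (fun _ => 1) (fun _ => 0) (fun t => hasDerivAt_const t 1)
  have e2 := hstep (fun t => v * t) (fun _ => v) (fun t => by
    simpa using (hasDerivAt_id t).const_mul (v : ℝ))
  have e3 := hstep (fun t => v + v ^ 2 * t ^ 2) (fun t => v ^ 2 * (2 * t)) (fun t => by
    simpa using (((hasDerivAt_id t).pow 2).const_mul ((v : ℝ) ^ 2)).const_add (v : ℝ))
  have e4 := hstep (fun t => 3 * v ^ 2 * t + v ^ 3 * t ^ 3)
    (fun t => 3 * v ^ 2 + v ^ 3 * (3 * t ^ 2)) (fun t => by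
    simpa using ((hasDerivAt_id t).const_mul (3 * (v : ℝ) ^ 2)).fun_add
      (((hasDerivAt_id t).pow 3).const_mul ((v : ℝ) ^ 3)))
  have hm : mgf id (gaussianReal 0 v) = fun t => 1 * Real.exp (v * t ^ 2 / 2) := by
    rw [mgf_id_gaussianReal]; simp
  rw [hm, iteratedDeriv_succ, iteratedDeriv_succ, iteratedDeriv_succ, iteratedDeriv_succ,
    iteratedDeriv_zero, e1] at h
  have r1 : (fun t : ℝ => (0 + 1 * ((v : ℝ) * t)) * Real.exp (v * t ^ 2 / 2))
      = fun t => v * t * Real.exp (v * t ^ 2 / 2) := by ext; ring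
  rw [r1, e2] at h
  have r2 : (fun t : ℝ => ((v : ℝ) + v * t * (v * t)) * Real.exp (v * t ^ 2 / 2))
      = fun t => (v + v ^ 2 * t ^ 2) * Real.exp (v * t ^ 2 / 2) := by ext; ring
  rw [r2, e3] at h
  have r3 : (fun t : ℝ => ((v : ℝ) ^ 2 * (2 * t) + (v + v ^ 2 * t ^ 2) * (v * t))
        * Real.exp (v * t ^ 2 / 2))
      = fun t => (3 * v ^ 2 * t + v ^ 3 * t ^ 3) * Real.exp (v * t ^ 2 / 2) := by ext; ring
  rw [r3, e4] at h
  simpa using h.symm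

section GaussianMoments

variable {Ω : Type*} [MeasureSpace Ω]

lemma integrable_pow_of_map_gaussianReal {X : Ω → ℝ} {v : NNReal} (hX : Measurable X)
    (h : Measure.map X ℙ = gaussianReal 0 v) (n : ℕ) : Integrable fun ω => X ω ^ n := by
  have h1 : Integrable (fun x : ℝ => x ^ n) (gaussianReal 0 v) := by
    have := (memLp_id_gaussianReal (μ := 0) (v := v) n).integrable_norm_pow'
    refine this.mono (by fun_prop) (by simp)
  rw [← h] at h1
  exact h1.comp_measurable hX

lemma integral_pow_four_of_map_gaussianReal {X : Ω → ℝ} {v : NNReal} (hX : Measurable X)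
    (h : Measure.map X ℙ = gaussianReal 0 v) : ∫ ω, X ω ^ 4 = 3 * (v : ℝ) ^ 2 := by
  rw [← integral_pow_four_gaussianReal, ← h, integral_map hX.aemeasurable (by fun_prop)]

lemma integral_sq_of_map_gaussianReal {X : Ω → ℝ} {v : NNReal} (hX : Measurable X)
    (h : Measure.map X ℙ = gaussianReal 0 v) : ∫ ω, X ω ^ 2 = v := by
  have h1 := variance_fun_id_gaussianReal (μ := 0) (v := v)
  rw [variance_eq_integral (by fun_prop), integral_id_gaussianReal] at h1
  rw [← h1, ← h, integral_map hX.aemeasurable (by fun_prop)]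
  simp

/-- If every linear combination of `W` is centered Gaussian with variance `|c|²`, then the mean
square deviation of `|W|² / N` from `1` equals `2 / N`. -/
lemma integral_sq_normalized_sum_sq [IsProbabilityMeasure (ℙ : Measure Ω)] {N : ℕ} (hN : 0 < N)
    (W : Fin N → Ω → ℝ) (hW : ∀ i, Measurable (W i))
    (hlaw : ∀ c : Fin N → ℝ, Measure.map (fun ω => ∑ i, c i * W i ω) ℙ
      = gaussianReal 0 (∑ i, c i ^ 2).toNNReal) :
    Integrable (fun ω => ((∑ i, W i ω ^ 2) / N - 1) ^ 2) ∧
      ∫ ω, ((∑ i, W i ω ^ 2) / N - 1) ^ 2 = (2 / N : ℝ) := by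
  classical
  have hone : ∀ i, Measure.map (W i) ℙ = gaussianReal 0 1 := by
    intro i
    have := hlaw (Pi.single i 1)
    simpa [Pi.single_apply, ite_pow] using this
  have hpm : ∀ i j, i ≠ j → ∀ s : ℝ, s ^ 2 = 1 →
      Measure.map (fun ω => W i ω + s * W j ω) ℙ = gaussianReal 0 2 := by
    intro i j hij s hs
    have := hlaw (Pi.single i 1 + Pi.single j s)
    have e : ∑ k, (Pi.single i 1 + Pi.single j s : Fin N → ℝ) k ^ 2 = 2 := by
      have : ∀ k, (Pi.single i 1 + Pi.single j s : Fin N → ℝ) k ^ 2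
          = (if k = i then 1 else 0) + (if k = j then 1 else 0) := by
        intro k
        by_cases hk : k = i
        · subst hk; simp [hij]
        · by_cases hk' : k = j
          · subst hk'; simp [hk, hs]
          · simp [hk, hk']
      simp only [this, Finset.sum_add_distrib, Finset.sum_ite_eq', Finset.mem_univ, if_true]
      norm_num
    rw [e] at this
    simpa [Pi.single_apply, add_mul, Finset.sum_add_distrib] using this
  have i4 : ∀ i, Integrable fun ω => W i ω ^ 4 :=
    fun i => integrable_pow_of_map_gaussianReal (hW i) (hone i) 4
  have i2 : ∀ i, Integrable fun ω => W i ω ^ 2 :=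
    fun i => integrable_pow_of_map_gaussianReal (hW i) (hone i) 2
  have m4 : ∀ i, ∫ ω, W i ω ^ 4 = 3 := fun i => by
    simpa using integral_pow_four_of_map_gaussianReal (hW i) (hone i)
  have m2 : ∀ i, ∫ ω, W i ω ^ 2 = 1 := fun i => by
    simpa using integral_sq_of_map_gaussianReal (hW i) (hone i)
  have mixed : ∀ i j, Integrable (fun ω => W i ω ^ 2 * W j ω ^ 2) ∧
      ∫ ω, W i ω ^ 2 * W j ω ^ 2 = if i = j then 3 else 1 := by
    intro i j
    by_cases hij : i = j
    · subst hij
      have : ∀ ω, W i ω ^ 2 * W i ω ^ 2 = W i ω ^ 4 := fun ω => by ring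
      simp only [this, if_true]
      exact ⟨i4 i, m4 i⟩
    · have hp := hpm i j hij 1 (by norm_num)
      have hq := hpm i j hij (-1) (by norm_num)
      have mp : Measurable fun ω => W i ω + 1 * W j ω := (hW i).add ((hW j).const_mul 1)
      have mq : Measurable fun ω => W i ω + (-1) * W j ω := (hW i).add ((hW j).const_mul (-1))
      have ip := integrable_pow_of_map_gaussianReal mp hp 4
      have iq := integrable_pow_of_map_gaussianReal mq hq 4
      have ep := integral_pow_four_of_map_gaussianReal mp hp
      have eq := integral_pow_four_of_map_gaussianReal mq hq
      have e : (fun ω => W i ω ^ 2 * W j ω ^ 2) = fun ω =>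
          (1 / 12 : ℝ) * (((W i ω + 1 * W j ω) ^ 4 + (W i ω + (-1) * W j ω) ^ 4)
            - 2 * (W i ω ^ 4 + W j ω ^ 4)) := by
        ext ω; ring
      rw [e]
      refine ⟨((ip.fun_add iq).sub (((i4 i).fun_add (i4 j)).const_mul 2)).const_mul _, ?_⟩
      rw [integral_const_mul, integral_sub (ip.fun_add iq) (((i4 i).fun_add (i4 j)).const_mul 2),
        integral_add ip iq, integral_const_mul, integral_add (i4 i) (i4 j), m4, m4, ep, eq]
      simp [hij]; norm_num
  have hN' : (N : ℝ) ≠ 0 := by positivity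
  have e : (fun ω => ((∑ i, W i ω ^ 2) / N - 1) ^ 2) = fun ω =>
      (1 / (N : ℝ) ^ 2) * (∑ i, ∑ j, W i ω ^ 2 * W j ω ^ 2)
        - (2 / N) * (∑ i, W i ω ^ 2) + 1 := by
    ext ω
    rw [← Finset.sum_mul_sum]
    field_simp
    ring
  have I1 : Integrable fun ω => ∑ i, ∑ j, W i ω ^ 2 * W j ω ^ 2 :=
    integrable_finsetSum _ fun i _ => integrable_finsetSum _ fun j _ => (mixed i j).1
  have I2 : Integrable fun ω => ∑ i, W i ω ^ 2 := integrable_finsetSum _ fun i _ => i2 i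
  have I3 : Integrable fun ω => (1 / (N : ℝ) ^ 2) * (∑ i, ∑ j, W i ω ^ 2 * W j ω ^ 2)
      - (2 / N) * (∑ i, W i ω ^ 2) := (I1.const_mul _).sub (I2.const_mul _)
  rw [e]
  refine ⟨I3.add (integrable_const 1), ?_⟩
  rw [integral_add I3 (integrable_const 1),
    integral_sub (I1.const_mul _) (I2.const_mul _), integral_const_mul, integral_const_mul,
    integral_finsetSum _ fun i _ => i2 i,
    integral_finsetSum _ fun i _ => integrable_finsetSum _ fun j _ => (mixed i j).1]
  have : ∀ i, ∫ ω, ∑ j, W i ω ^ 2 * W j ω ^ 2 = N + 2 := by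
    intro i
    rw [integral_finsetSum _ fun j _ => (mixed i j).1]
    simp only [(mixed i _).2]
    have : ∀ j, (if i = j then (3 : ℝ) else 1) = 1 + if i = j then 2 else 0 := by
      intro j; split_ifs <;> norm_num
    simp only [this, Finset.sum_add_distrib]
    simp
  simp only [this, m2]
  simp
  field_simp
  ring

end GaussianMoments

section SpectralBound

open Set

lemma integrableOn_one_sub_cos_mul_rpow {α : ℝ} (h0 : 0 < α) (h2 : α < 2) (x : ℝ) :
    IntegrableOn (fun ξ : ℝ => (1 - Real.cos (x * ξ)) * ξ ^ (-1 - α)) (Ioi 0) := by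
  have hmeas : Measurable fun ξ : ℝ => (1 - Real.cos (x * ξ)) * ξ ^ (-1 - α) := by fun_prop
  rw [← Ioc_union_Ioi_eq_Ioi (zero_le_one' ℝ)]
  refine IntegrableOn.union ?_ ?_
  · have h : IntegrableOn (fun ξ : ℝ => x ^ 2 / 2 * ξ ^ (1 - α)) (Ioc 0 1) := by
      have := intervalIntegral.intervalIntegrable_rpow' (a := 0) (b := 1)
        (show -1 < 1 - α by linarith)
      rw [intervalIntegrable_iff_integrableOn_Ioc_of_le zero_le_one] at this
      exact this.const_mul _
    refine Integrable.mono' h hmeas.aestronglyMeasurable ?_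
    filter_upwards [ae_restrict_mem measurableSet_Ioc] with ξ hξ
    have hp : 0 < ξ ^ (-1 - α) := Real.rpow_pos_of_pos hξ.1 _
    rw [Real.norm_of_nonneg (mul_nonneg (by linarith [Real.cos_le_one (x * ξ)]) hp.le),
      show (1 - α) = 2 + (-1 - α) by ring, Real.rpow_add hξ.1, ← mul_assoc]
    gcongr
    have := Real.one_sub_sq_div_two_le_cos (x := x * ξ)
    rw [Real.rpow_two]
    nlinarith
  · have h : IntegrableOn (fun ξ : ℝ => 2 * ξ ^ (-1 - α)) (Ioi 1) :=
      (integrableOn_Ioi_rpow_of_lt (by linarith) zero_lt_one).const_mul _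
    refine Integrable.mono' h hmeas.aestronglyMeasurable ?_
    filter_upwards [ae_restrict_mem measurableSet_Ioi] with ξ hξ
    have hp : 0 < ξ ^ (-1 - α) := Real.rpow_pos_of_pos (zero_lt_one.trans hξ) _
    rw [Real.norm_of_nonneg (mul_nonneg (by linarith [Real.cos_le_one (x * ξ)]) hp.le)]
    gcongr
    linarith [Real.neg_one_le_cos (x * ξ)]

lemma integral_one_sub_cos_mul_rpow {α : ℝ} (h0 : 0 < α) (x : ℝ) :
    ∫ ξ in Ioi (0 : ℝ), (1 - Real.cos (x * ξ)) * ξ ^ (-1 - α)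
      = (∫ ξ in Ioi (0 : ℝ), (1 - Real.cos ξ) * ξ ^ (-1 - α)) * |x| ^ α := by
  rcases eq_or_ne x 0 with rfl | hx
  · simp [Real.zero_rpow h0.ne']
  have hx' : 0 < |x| := abs_pos.mpr hx
  have h := integral_comp_mul_left_Ioi (fun ξ : ℝ => (1 - Real.cos ξ) * ξ ^ (-1 - α)) 0 hx'
  have e : ∫ ξ in Ioi (0 : ℝ), (1 - Real.cos (|x| * ξ)) * (|x| * ξ) ^ (-1 - α)
      = |x| ^ (-1 - α) * ∫ ξ in Ioi (0 : ℝ), (1 - Real.cos (x * ξ)) * ξ ^ (-1 - α) := by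
    rw [← integral_const_mul]
    refine setIntegral_congr_fun measurableSet_Ioi fun ξ hξ => ?_
    have hξ' : (0 : ℝ) < ξ := hξ
    have hc : Real.cos (|x| * ξ) = Real.cos (x * ξ) := by
      rw [← Real.cos_abs (x * ξ), abs_mul, abs_of_pos hξ']
    simp only [hc]
    rw [Real.mul_rpow hx'.le hξ'.le]
    ring
  rw [e, mul_zero, smul_eq_mul] at h
  have hpow : |x| ^ (-1 - α) * |x| ^ α = |x|⁻¹ := by
    rw [← Real.rpow_add hx', ← Real.rpow_neg_one]; ring_nf
  have hne : |x| ^ (-1 - α) ≠ 0 := (Real.rpow_pos_of_pos hx' _).ne'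
  apply mul_left_cancel₀ hne
  rw [h, ← hpow]
  ring

lemma rpow_mul_one_sub_cos_ge {α : ℝ} (h1 : 1 ≤ α) {ξ : ℝ} (hξ : ξ ∈ Ioc 0 Real.pi) :
    2 / Real.pi ^ 2 * Real.pi ^ (1 - α) ≤ (1 - Real.cos ξ) * ξ ^ (-1 - α) := by
  have hp : 0 < ξ ^ (-1 - α) := Real.rpow_pos_of_pos hξ.1 _
  have : Real.pi ^ (1 - α) ≤ ξ ^ (1 - α) :=
    Real.rpow_le_rpow_of_nonpos hξ.1 hξ.2 (by linarith)
  calc 2 / Real.pi ^ 2 * Real.pi ^ (1 - α) ≤ 2 / Real.pi ^ 2 * ξ ^ (1 - α) := by gcongr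
    _ = (2 / Real.pi ^ 2 * ξ ^ 2) * ξ ^ (-1 - α) := by
      rw [show (1 - α) = 2 + (-1 - α) by ring, Real.rpow_add hξ.1, Real.rpow_two]; ring
    _ ≤ _ := by
      gcongr
      have := Real.cos_le_one_sub_mul_cos_sq (x := ξ) (by rw [abs_of_pos hξ.1]; exact hξ.2)
      linarith

lemma integral_one_sub_cos_mul_rpow_pos {α : ℝ} (h1 : 1 ≤ α) (h2 : α < 2) :
    0 < ∫ ξ in Ioi (0 : ℝ), (1 - Real.cos ξ) * ξ ^ (-1 - α) := by
  have hint := integrableOn_one_sub_cos_mul_rpow (by linarith) h2 1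
  simp only [one_mul] at hint
  have hsub : Ioc 0 Real.pi ⊆ Ioi (0 : ℝ) := Ioc_subset_Ioi_self
  calc 0 < ∫ _ in Ioc 0 Real.pi, 2 / Real.pi ^ 2 * Real.pi ^ (1 - α) := by
        have : 0 < 2 / Real.pi ^ 2 * Real.pi ^ (1 - α) * Real.pi := by positivity
        simpa [Real.pi_pos.le, mul_comm] using this
    _ ≤ ∫ ξ in Ioc 0 Real.pi, (1 - Real.cos ξ) * ξ ^ (-1 - α) :=
        setIntegral_mono_on (integrableOn_const (by simp)) (hint.mono_set hsub) measurableSet_Ioc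
          fun ξ hξ => rpow_mul_one_sub_cos_ge h1 hξ
    _ ≤ _ := by
        refine setIntegral_mono_set hint ?_ hsub.eventuallyLE
        filter_upwards [ae_restrict_mem measurableSet_Ioi] with ξ hξ
        exact mul_nonneg (by linarith [Real.cos_le_one ξ]) (Real.rpow_nonneg (le_of_lt hξ) _)

/-- Spectral representation of the autocovariance of fractional Gaussian noise. -/
lemma integral_cos_mul_one_sub_cos_mul_rpow {α : ℝ} (h0 : 0 < α) (h2 : α < 2) (m : ℝ) :
    IntegrableOn (fun ξ : ℝ => Real.cos (m * ξ) * ((1 - Real.cos ξ) * ξ ^ (-1 - α))) (Ioi 0) ∧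
    ∫ ξ in Ioi (0 : ℝ), Real.cos (m * ξ) * ((1 - Real.cos ξ) * ξ ^ (-1 - α))
      = (∫ ξ in Ioi (0 : ℝ), (1 - Real.cos ξ) * ξ ^ (-1 - α))
        * ((|m + 1| ^ α + |m - 1| ^ α - 2 * |m| ^ α) / 2) := by
  have i := integrableOn_one_sub_cos_mul_rpow h0 h2
  have e : (fun ξ : ℝ => Real.cos (m * ξ) * ((1 - Real.cos ξ) * ξ ^ (-1 - α))) = fun ξ =>
      (1 / 2 : ℝ) * (((1 - Real.cos ((m + 1) * ξ)) * ξ ^ (-1 - α)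
        + (1 - Real.cos ((m - 1) * ξ)) * ξ ^ (-1 - α))
        - 2 * ((1 - Real.cos (m * ξ)) * ξ ^ (-1 - α))) := by
    ext ξ
    rw [show (m + 1) * ξ = m * ξ + ξ by ring, show (m - 1) * ξ = m * ξ - ξ by ring,
      Real.cos_add, Real.cos_sub]
    ring
  have i3 := (i (m + 1)).fun_add (i (m - 1))
  have i4 := (i m).const_mul 2
  rw [e]
  refine ⟨(i3.sub i4).const_mul _, ?_⟩
  rw [integral_const_mul, integral_sub i3 i4, integral_add (i (m + 1)) (i (m - 1)),
    integral_const_mul]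
  simp only [integral_one_sub_cos_mul_rpow h0]
  ring

lemma sum_sum_mul_cos_sub {N : ℕ} (a : Fin N → ℝ) (ξ : ℝ) :
    ∑ i, ∑ j, a i * a j * Real.cos (((i : ℝ) - (j : ℝ)) * ξ)
      = (∑ i, a i * Real.cos ((i : ℝ) * ξ)) ^ 2 + (∑ i, a i * Real.sin ((i : ℝ) * ξ)) ^ 2 := by
  rw [sq, sq, Finset.sum_mul_sum, Finset.sum_mul_sum, ← Finset.sum_add_distrib]
  refine Finset.sum_congr rfl fun i _ => ?_
  rw [← Finset.sum_add_distrib]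
  refine Finset.sum_congr rfl fun j _ => ?_
  rw [sub_mul, Real.cos_sub]
  ring

lemma integral_sum_sum_mul_cos_sub {N : ℕ} (a : Fin N → ℝ) :
    ∫ ξ in (0 : ℝ)..Real.pi, ∑ i, ∑ j, a i * a j * Real.cos (((i : ℝ) - (j : ℝ)) * ξ)
      = Real.pi * ∑ i, a i ^ 2 := by
  have hc : ∀ i j : Fin N, ∫ ξ in (0 : ℝ)..Real.pi, Real.cos (((i : ℝ) - (j : ℝ)) * ξ)
      = if i = j then Real.pi else 0 := by
    intro i j
    split_ifs with h
    · simp [h]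
    · have hne : (i : ℝ) - (j : ℝ) ≠ 0 := by
        rw [sub_ne_zero]
        exact_mod_cast fun h' => h (Fin.ext h')
      rw [intervalIntegral.integral_comp_mul_left _ hne, integral_cos]
      have := Real.sin_int_mul_pi ((i : ℤ) - (j : ℤ))
      push_cast at this
      simp [this]
  rw [intervalIntegral.integral_finsetSum fun i _ =>
    (by fun_prop : Continuous _).intervalIntegrable _ _, Finset.mul_sum]
  refine Finset.sum_congr rfl fun i _ => ?_
  rw [intervalIntegral.integral_finsetSum fun j _ =>
    (by fun_prop : Continuous _).intervalIntegrable _ _]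
  simp only [intervalIntegral.integral_const_mul, hc]
  simp
  ring

/-- For `1/2 ≤ H < 1` the covariance matrices of unit-mesh fractional Gaussian noise are bounded
below, uniformly in their size. -/
lemma exists_le_sum_sum_SigmaH_one {H : ℝ} (h1 : 1 / 2 ≤ H) (h2 : H < 1) :
    ∃ m > 0, ∀ (N : ℕ) (a : Fin N → ℝ),
      m * ∑ i, a i ^ 2 ≤ ∑ i, ∑ j, a i * a j * SigmaH H 1 N i j := by
  set α := 2 * H with hα
  have hα1 : 1 ≤ α := by linarith
  have hα2 : α < 2 := by linarith
  set K := ∫ ξ in Ioi (0 : ℝ), (1 - Real.cos ξ) * ξ ^ (-1 - α) with hK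
  have hKpos : 0 < K := integral_one_sub_cos_mul_rpow_pos hα1 hα2
  set b := 2 / Real.pi ^ 2 * Real.pi ^ (1 - α) with hb
  have hbpos : 0 < b := by positivity
  refine ⟨b * Real.pi / K, by positivity, fun N a => ?_⟩
  have hS := fun m => integral_cos_mul_one_sub_cos_mul_rpow (by linarith) hα2 m
  have ientry : ∀ i j : Fin N, IntegrableOn (fun ξ : ℝ => a i * a j *
      (Real.cos (((i : ℝ) - (j : ℝ)) * ξ) * ((1 - Real.cos ξ) * ξ ^ (-1 - α)))) (Ioi 0) :=
    fun i j => (hS _).1.const_mul _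
  have hrep : K * ∑ i, ∑ j, a i * a j * SigmaH H 1 N i j = ∫ ξ in Ioi (0 : ℝ),
      (∑ i, ∑ j, a i * a j * Real.cos (((i : ℝ) - (j : ℝ)) * ξ))
        * ((1 - Real.cos ξ) * ξ ^ (-1 - α)) := by
    simp only [Finset.sum_mul, mul_assoc]
    simp only [← mul_assoc (a _) (a _)]
    rw [integral_finsetSum _ fun i _ => integrable_finsetSum _ fun j _ => ientry i j,
      Finset.mul_sum]
    refine Finset.sum_congr rfl fun i _ => ?_
    rw [integral_finsetSum _ fun j _ => ientry i j, Finset.mul_sum]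
    refine Finset.sum_congr rfl fun j _ => ?_
    rw [integral_const_mul, (hS _).2, SigmaH, Real.one_rpow, ← hα, ← hK]
    ring
  have hint : IntegrableOn (fun ξ : ℝ =>
      (∑ i, ∑ j, a i * a j * Real.cos (((i : ℝ) - (j : ℝ)) * ξ))
        * ((1 - Real.cos ξ) * ξ ^ (-1 - α))) (Ioi 0) := by
    simp only [Finset.sum_mul, mul_assoc]
    simp only [← mul_assoc (a _) (a _)]
    exact integrable_finsetSum _ fun i _ => integrable_finsetSum _ fun j _ => ientry i j
  have hP : ∀ ξ : ℝ, 0 ≤ ∑ i, ∑ j, a i * a j * Real.cos (((i : ℝ) - (j : ℝ)) * ξ) := by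
    intro ξ; rw [sum_sum_mul_cos_sub]; positivity
  have hsub : Ioc 0 Real.pi ⊆ Ioi (0 : ℝ) := Ioc_subset_Ioi_self
  rw [div_mul_eq_mul_div, div_le_iff₀ hKpos, mul_comm _ K, hrep]
  calc b * Real.pi * ∑ i, a i ^ 2
      = ∫ ξ in Ioc 0 Real.pi,
          (∑ i, ∑ j, a i * a j * Real.cos (((i : ℝ) - (j : ℝ)) * ξ)) * b := by
        rw [integral_mul_const, ← intervalIntegral.integral_of_le Real.pi_pos.le,
          integral_sum_sum_mul_cos_sub]
        ring
    _ ≤ ∫ ξ in Ioc 0 Real.pi, (∑ i, ∑ j, a i * a j * Real.cos (((i : ℝ) - (j : ℝ)) * ξ))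
        * ((1 - Real.cos ξ) * ξ ^ (-1 - α)) := by
        refine setIntegral_mono_on ?_ (hint.mono_set hsub) measurableSet_Ioc fun ξ hξ =>
          mul_le_mul_of_nonneg_left (rpow_mul_one_sub_cos_ge hα1 hξ) (hP ξ)
        exact ((by fun_prop : Continuous fun ξ : ℝ =>
          (∑ i, ∑ j, a i * a j * Real.cos (((i : ℝ) - (j : ℝ)) * ξ)) * b).integrableOn_Icc).mono_set
            Ioc_subset_Icc_self
    _ ≤ _ := by
        refine setIntegral_mono_set hint ?_ hsub.eventuallyLE
        filter_upwards [ae_restrict_mem measurableSet_Ioi] with ξ hξ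
        exact mul_nonneg (hP ξ)
          (mul_nonneg (by linarith [Real.cos_le_one ξ]) (Real.rpow_nonneg (le_of_lt hξ) _))

lemma SigmaH_eq_mul_SigmaH_one (H δ : ℝ) (N : ℕ) (i j : Fin N) :
    SigmaH H δ N i j = δ ^ (2 * H) * SigmaH H 1 N i j := by
  simp only [SigmaH, Real.one_rpow]
  ring

end SpectralBound

section QuadraticForms

lemma dotProduct_inv_mulVec_le {N : ℕ} {S : Matrix (Fin N) (Fin N) ℝ} {m : ℝ} (hm : 0 < m)
    (hS : S.PosDef) (hle : ∀ a : Fin N → ℝ, m * ∑ i, a i ^ 2 ≤ a ⬝ᵥ (S *ᵥ a))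
    (z : Fin N → ℝ) : z ⬝ᵥ (S⁻¹ *ᵥ z) ≤ (∑ i, z i ^ 2) / m := by
  set y := S⁻¹ *ᵥ z with hy
  have hSy : S *ᵥ y = z := by
    rw [hy, mulVec_mulVec, mul_nonsing_inv _ ((isUnit_iff_isUnit_det _).1 hS.isUnit), one_mulVec]
  have h1 := hle y
  rw [hSy, dotProduct_comm] at h1
  have h2 : (z ⬝ᵥ y) ^ 2 ≤ (∑ i, z i ^ 2) * ∑ i, y i ^ 2 :=
    Finset.sum_mul_sq_le_sq_mul_sq Finset.univ z y
  have hz : 0 ≤ ∑ i, z i ^ 2 := Finset.sum_nonneg fun i _ => sq_nonneg _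
  have hy0 : 0 ≤ ∑ i, y i ^ 2 := Finset.sum_nonneg fun i _ => sq_nonneg _
  rw [le_div_iff₀ hm]
  rcases eq_or_lt_of_le (show 0 ≤ z ⬝ᵥ y from le_trans (by positivity) h1) with h0 | h0
  · rw [← h0]; simpa using hz
  · have : (z ⬝ᵥ y) * ((z ⬝ᵥ y) * m) ≤ (z ⬝ᵥ y) * ∑ i, z i ^ 2 := by nlinarith
    exact le_of_mul_le_mul_left this h0

open scoped MatrixOrder in
lemma Matrix.PosDef.exists_inv_eq_transpose_mul {N : ℕ} {S : Matrix (Fin N) (Fin N) ℝ}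
    (hS : S.PosDef) : ∃ L : Matrix (Fin N) (Fin N) ℝ, S⁻¹ = Lᵀ * L ∧ L * S * Lᵀ = 1 := by
  have hnn : 0 ≤ S⁻¹ := hS.inv.posSemidef.nonneg
  have hsa : (CFC.sqrt S⁻¹)ᵀ = CFC.sqrt S⁻¹ := by
    have h : star (CFC.sqrt S⁻¹) = CFC.sqrt S⁻¹ := IsSelfAdjoint.of_nonneg (CFC.sqrt_nonneg _)
    rwa [star_eq_conjTranspose, conjTranspose_eq_transpose_of_trivial] at h
  have hL : S⁻¹ = (CFC.sqrt S⁻¹)ᵀ * CFC.sqrt S⁻¹ := by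
    rw [hsa, CFC.sqrt_mul_sqrt_self _ hnn]
  refine ⟨CFC.sqrt S⁻¹, hL, ?_⟩
  have h1 : (CFC.sqrt S⁻¹)ᵀ * (CFC.sqrt S⁻¹ * S) = 1 := by
    rw [← mul_assoc, ← hL, nonsing_inv_mul _ ((isUnit_iff_isUnit_det _).1 hS.isUnit)]
  exact mul_eq_one_comm.1 h1

lemma dotProduct_transpose_mul_mulVec {N : ℕ} (L : Matrix (Fin N) (Fin N) ℝ) (x : Fin N → ℝ) :
    x ⬝ᵥ ((Lᵀ * L) *ᵥ x) = ∑ i, (L *ᵥ x) i ^ 2 := by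
  rw [← mulVec_mulVec, dotProduct_mulVec, vecMul_transpose]
  simp [dotProduct, sq]

/-- Deterministic error estimate: perturbing `W` by `R` in the normalised squared length. -/
lemma sq_normalized_sum_sq_sub_le {N : ℕ} (hN : 0 < N) (W R : Fin N → ℝ) {l : ℝ} (hl : 0 < l) :
    ((∑ i, (W i - R i) ^ 2) / N - 1) ^ 2 ≤
      3 * ((1 + 4 * l) * ((∑ i, W i ^ 2) / N - 1) ^ 2 + 4 * l
        + (1 + 2 / l) * ((∑ i, R i ^ 2) / N) ^ 2) := by
  have hN' : (0 : ℝ) < N := by exact_mod_cast hN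
  set A := (∑ i, W i ^ 2) / (N : ℝ) with hA
  set D := (∑ i, R i ^ 2) / (N : ℝ) with hD
  set X := (∑ i, W i * R i) / (N : ℝ) with hX
  have hA0 : 0 ≤ A := by positivity
  have hD0 : 0 ≤ D := by positivity
  have hX2 : X ^ 2 ≤ A * D := by
    have := Finset.sum_mul_sq_le_sq_mul_sq Finset.univ W R
    rw [hX, hA, hD, div_pow, div_mul_div_comm, sq (N : ℝ)]
    gcongr
  have e : (∑ i, (W i - R i) ^ 2) / (N : ℝ) = A - 2 * X + D := by
    rw [hA, hD, hX, mul_div_assoc', Finset.mul_sum, ← sub_div, ← add_div,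
      ← Finset.sum_sub_distrib, ← Finset.sum_add_distrib]
    congr 1
    exact Finset.sum_congr rfl fun i _ => by ring
  have hAD : 2 * (A * D) ≤ l * A ^ 2 + D ^ 2 / l := by
    have : l * A ^ 2 + D ^ 2 / l - 2 * (A * D) = (l * A - D) ^ 2 / l := by
      field_simp; ring
    have : 0 ≤ (l * A - D) ^ 2 / l := by positivity
    linarith
  have hAA : A ^ 2 ≤ 2 * (A - 1) ^ 2 + 2 := by nlinarith [sq_nonneg (A - 2)]
  have hlA : l * A ^ 2 ≤ l * (2 * (A - 1) ^ 2 + 2) := by gcongr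
  have e2 : (1 + 2 / l) * D ^ 2 = D ^ 2 + 2 * (D ^ 2 / l) := by ring
  rw [e, e2]
  nlinarith [sq_nonneg ((A - 1) + 2 * X), sq_nonneg ((A - 1) - D), sq_nonneg (2 * X + D)]

lemma sq_normalized_sum_sq_le {N : ℕ} (hN : 0 < N) (Z : Fin N → ℝ) :
    ((∑ i, Z i ^ 2) / N) ^ 2 ≤ (∑ i, Z i ^ 4) / N := by
  have hN' : (0 : ℝ) < N := by exact_mod_cast hN
  have h := sq_sum_le_card_mul_sum_sq (s := Finset.univ) (f := fun i => Z i ^ 2)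
  rw [div_pow, div_le_div_iff₀ (by positivity) hN']
  have e : ∑ i, (Z i ^ 2) ^ 2 = ∑ i, Z i ^ 4 := Finset.sum_congr rfl fun i _ => by ring
  simp only [Finset.card_univ, Fintype.card_fin, e] at h
  nlinarith

end QuadraticForms

section IncrementCovariance

lemma SigmaH_eq_fbmCov {H δ : ℝ} (hδ : 0 < δ) {N : ℕ} (i j : Fin N) :
    SigmaH H δ N i j = fbmCov H ((i + 1 : ℝ) * δ) ((j + 1 : ℝ) * δ)
      - fbmCov H ((i + 1 : ℝ) * δ) ((j : ℝ) * δ) - fbmCov H ((i : ℝ) * δ) ((j + 1 : ℝ) * δ)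
      + fbmCov H ((i : ℝ) * δ) ((j : ℝ) * δ) := by
  simp only [SigmaH, fbmCov]
  rw [← sub_mul, ← sub_mul, ← sub_mul, ← sub_mul]
  rw [show ((i : ℝ) + 1 - (j + 1)) = i - j by ring, show ((i : ℝ) + 1 - j) = i - j + 1 by ring,
    show ((i : ℝ) - (j + 1)) = i - j - 1 by ring]
  simp only [abs_mul, abs_of_pos hδ, Real.mul_rpow (abs_nonneg _) hδ.le]
  ring

lemma SigmaH_isHermitian (H δ : ℝ) (N : ℕ) : (SigmaH H δ N).IsHermitian := by
  ext i j
  simp only [conjTranspose_apply, star_trivial, SigmaH]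
  rw [← abs_neg ((j : ℝ) - i + 1), ← abs_neg ((j : ℝ) - i - 1), ← abs_neg ((j : ℝ) - i)]
  ring_nf

/-- Uniform ellipticity of the covariance matrices of fractional Gaussian noise. -/
lemma exists_le_dotProduct_SigmaH {H : ℝ} (h1 : 1 / 2 ≤ H) (h2 : H < 1) :
    ∃ m > 0, ∀ (δ : ℝ), 0 < δ → ∀ (N : ℕ) (a : Fin N → ℝ),
      m * δ ^ (2 * H) * ∑ i, a i ^ 2 ≤ a ⬝ᵥ (SigmaH H δ N *ᵥ a) := by
  obtain ⟨m, hm, h⟩ := exists_le_sum_sum_SigmaH_one h1 h2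
  refine ⟨m, hm, fun δ hδ N a => ?_⟩
  have hp : 0 ≤ δ ^ (2 * H) := Real.rpow_nonneg hδ.le _
  calc m * δ ^ (2 * H) * ∑ i, a i ^ 2 = δ ^ (2 * H) * (m * ∑ i, a i ^ 2) := by ring
    _ ≤ δ ^ (2 * H) * ∑ i, ∑ j, a i * a j * SigmaH H 1 N i j := by gcongr; exact h N a
    _ = _ := by
      simp only [dotProduct, mulVec, Finset.mul_sum]
      refine Finset.sum_congr rfl fun i _ => Finset.sum_congr rfl fun j _ => ?_
      rw [SigmaH_eq_mul_SigmaH_one H δ]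
      ring

lemma posDef_SigmaH {H δ : ℝ} (h1 : 1 / 2 ≤ H) (h2 : H < 1) (hδ : 0 < δ) (N : ℕ) :
    (SigmaH H δ N).PosDef := by
  obtain ⟨m, hm, h⟩ := exists_le_dotProduct_SigmaH h1 h2
  refine .of_dotProduct_mulVec_pos (SigmaH_isHermitian H δ N) fun x hx => ?_
  rw [star_trivial]
  refine lt_of_lt_of_le ?_ (h δ hδ N x)
  obtain ⟨i, hi⟩ := Function.ne_iff.1 hx
  have : 0 < ∑ i, x i ^ 2 :=
    Finset.sum_pos' (fun i _ => sq_nonneg _) ⟨i, Finset.mem_univ i, by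
      have : x i ≠ 0 := hi
      positivity⟩
  positivity

variable {Ω : Type*} [MeasureSpace Ω] {H : ℝ} {B : ℝ → Ω → ℝ}

/-- Linear combinations of grid increments of fractional Brownian motion are centered Gaussian
with covariance matrix `SigmaH`. -/
lemma IsTwoSidedFBM.map_sum_increments (hB : IsTwoSidedFBM H B) {δ : ℝ} (hδ : 0 < δ) {N : ℕ}
    (a : Fin N → ℝ) :
    Measure.map (fun ω => ∑ k, a k * (B (((k : ℕ) + 1 : ℝ) * δ) ω - B ((k : ℕ) * δ) ω)) ℙ
      = gaussianReal 0 (a ⬝ᵥ (SigmaH H δ N *ᵥ a)).toNNReal := by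
  have h := hB.gaussian (N + N)
    (Fin.append (fun k : Fin N => ((k : ℕ) + 1 : ℝ) * δ) (fun k : Fin N => ((k : ℕ) : ℝ) * δ))
    (Fin.append a (-a))
  simp only [Fin.sum_univ_add, Fin.append_left, Fin.append_right, Pi.neg_apply] at h
  convert h using 2
  · ext ω
    rw [← Finset.sum_add_distrib]
    exact Finset.sum_congr rfl fun k _ => by ring
  · congr 1
    simp only [dotProduct, mulVec, Finset.mul_sum, ← Finset.sum_add_distrib]
    refine Finset.sum_congr rfl fun i _ => Finset.sum_congr rfl fun j _ => ?_
    rw [SigmaH_eq_fbmCov hδ]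
    ring

lemma IsTwoSidedFBM.map_sub (hB : IsTwoSidedFBM H B) (hH : 0 < H) (s t : ℝ) :
    Measure.map (fun ω => B t ω - B s ω) ℙ
      = gaussianReal 0 (|t - s| ^ (2 * H)).toNNReal := by
  have h := hB.gaussian 2 ![t, s] ![1, -1]
  simp only [Fin.sum_univ_two, fbmCov] at h
  have h0 : (0 : ℝ) ^ (2 * H) = 0 := Real.zero_rpow (by positivity)
  convert h using 2
  · ext ω; simp; ring
  · congr 1
    simp [h0, abs_sub_comm s t]
    ring

end IncrementCovariance

section PathIdentity

open Set

/-- Deviation of a path from its exponential moving average with time scale `ε`. -/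
def expSmoothingError (ε : ℝ) (b : ℝ → ℝ) (t : ℝ) : ℝ :=
  b t - (1 / ε) * ∫ s in Iic t, Real.exp (-(t - s) / ε) * b s

lemma integrableOn_exp_mul_of_abs {ε : ℝ} {b : ℝ → ℝ} (hb : Continuous b) {t : ℝ}
    (h : IntegrableOn (fun s => Real.exp (-(t - s) / ε) * |b s|) (Iic t)) :
    IntegrableOn (fun s => Real.exp (-(t - s) / ε) * b s) (Iic t) := by
  refine Integrable.mono h (by fun_prop) (Eventually.of_forall fun s => ?_)
  simp

lemma integral_expSmoothingError {ε : ℝ} (hε : 0 < ε) {b : ℝ → ℝ} (hb : Continuous b)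
    (h : ∀ t, IntegrableOn (fun s => Real.exp (-(t - s) / ε) * |b s|) (Iic t)) (t : ℝ) :
    ∫ s in (0 : ℝ)..t, expSmoothingError ε b s
      = ε * ((b t - expSmoothingError ε b t) - (b 0 - expSmoothingError ε b 0)) := by
  have hsplit : ∀ t s : ℝ, Real.exp (-(t - s) / ε) * b s
      = Real.exp (-t / ε) * (Real.exp (s / ε) * b s) := fun t s => by
    rw [← mul_assoc, ← Real.exp_add]; ring_nf
  have hJint : ∀ t, IntegrableOn (fun s => Real.exp (s / ε) * b s) (Iic t) := fun t => by
    have := (integrableOn_exp_mul_of_abs hb (h t)).const_mul (Real.exp (t / ε))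
    refine this.congr (Eventually.of_forall fun s => ?_)
    simp only [hsplit]
    rw [← mul_assoc, ← Real.exp_add]
    simp [neg_div]
  set F : ℝ → ℝ := fun t => Real.exp (-t / ε) * ∫ s in Iic t, Real.exp (s / ε) * b s with hF
  have hFeq : ∀ t, ∫ s in Iic t, Real.exp (-(t - s) / ε) * b s = F t := fun t => by
    simp only [hsplit, integral_const_mul, hF]
  have hc : Continuous fun s => Real.exp (s / ε) * b s := by fun_prop
  have hJ : ∀ t, HasDerivAt (fun t => ∫ s in Iic t, Real.exp (s / ε) * b s)
      (Real.exp (t / ε) * b t) t := fun t => by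
    have h1 : HasDerivAt (fun t => ∫ s in (0 : ℝ)..t, Real.exp (s / ε) * b s)
        (Real.exp (t / ε) * b t) t :=
      intervalIntegral.integral_hasDerivAt_right (hc.intervalIntegrable _ _)
        (hc.stronglyMeasurableAtFilter _ _) hc.continuousAt
    refine (h1.add_const (∫ s in Iic 0, Real.exp (s / ε) * b s)).congr_of_eventuallyEq
      (Eventually.of_forall fun u => ?_)
    simp only
    rw [← intervalIntegral.integral_Iic_sub_Iic (hJint 0) (hJint u)]
    ring
  have hFd : ∀ t, HasDerivAt F (b t - (1 / ε) * F t) t := fun t => by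
    have h1 : HasDerivAt (fun t : ℝ => -t / ε) (-1 / ε) t :=
      ((hasDerivAt_id t).neg).div_const ε
    refine (h1.exp.mul (hJ t)).congr_deriv ?_
    have : Real.exp (-t / ε) * (Real.exp (t / ε) * b t) = b t := by
      rw [← mul_assoc, ← Real.exp_add]; simp [neg_div]
    rw [this, hF]
    ring
  have hFc : Continuous F := continuous_iff_continuousAt.2 fun t => (hFd t).continuousAt
  have hE : ∀ t, expSmoothingError ε b t = b t - (1 / ε) * F t := fun t => by
    rw [expSmoothingError, hFeq]
  have hcont : Continuous fun t => b t - (1 / ε) * F t := by fun_prop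
  simp only [hE]
  rw [intervalIntegral.integral_eq_sub_of_hasDerivAt (fun x _ => hFd x)
    (hcont.intervalIntegrable _ _)]
  field_simp
  ring

lemma slowX_eq {Ω : Type*} [MeasureSpace Ω] {H σ ε : ℝ} (hε : 0 < ε) {B : ℝ → Ω → ℝ} {ω : Ω}
    (hb : Continuous fun t => B t ω) (h0 : B 0 ω = 0)
    (h : ∀ t, IntegrableOn (fun s => Real.exp (-(t - s) / ε) * |B s ω|) (Iic t)) (t : ℝ) :
    slowX H σ ε B t ω = σ * (B t ω - expSmoothingError ε (fun s => B s ω) t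
      + expSmoothingError ε (fun s => B s ω) 0) := by
  have := integral_expSmoothingError hε hb h t
  have e : ∀ s, fracOU H σ ε B s ω = (σ / ε ^ H) * expSmoothingError ε (fun s => B s ω) s :=
    fun s => rfl
  simp only [slowX, e, intervalIntegral.integral_const_mul, this, h0]
  rw [Real.rpow_sub hε, Real.rpow_one]
  have : ε ^ H ≠ 0 := (Real.rpow_pos_of_pos hε H).ne'
  field_simp
  ring

end PathIdentity

section SmoothingErrorMoment

open Set

/-- The standard exponential distribution. -/
def stdExp : Measure ℝ :=
  (volume.restrict (Ioi 0)).withDensity fun u => ENNReal.ofReal (Real.exp (-u))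

instance : IsProbabilityMeasure stdExp where
  measure_univ := by
    rw [stdExp, withDensity_apply _ MeasurableSet.univ, Measure.restrict_univ,
      ← ofReal_integral_eq_lintegral_ofReal _ (Eventually.of_forall fun u => (Real.exp_pos _).le),
      integral_exp_neg_Ioi_zero, ENNReal.ofReal_one]
    exact integrableOn_exp_neg_Ioi 0

lemma lintegral_rpow_stdExp_ne_top {p : ℝ} (hp : 0 < p) :
    ∫⁻ u, ENNReal.ofReal (|u| ^ p) ∂stdExp ≠ ⊤ := by
  rw [stdExp, lintegral_withDensity_eq_lintegral_mul _ (by fun_prop) (by fun_prop)]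
  have h := (Real.GammaIntegral_convergent (s := p + 1) (by linarith)).lintegral_lt_top
  refine ne_of_lt (lt_of_le_of_lt (lintegral_mono_ae ?_) h)
  filter_upwards [ae_restrict_mem measurableSet_Ioi] with u hu
  rw [Pi.mul_apply, ← ENNReal.ofReal_mul (Real.exp_pos _).le, abs_of_pos hu]
  simp

lemma integrable_comp_sub_mul_stdExp {ε : ℝ} (hε : 0 < ε) {b : ℝ → ℝ} {t : ℝ}
    (h : IntegrableOn (fun s => Real.exp (-(t - s) / ε) * b s) (Iic t)) :
    Integrable (fun u => b (t - ε * u)) stdExp ∧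
      ∫ u, b (t - ε * u) ∂stdExp = (1 / ε) * ∫ s in Iic t, Real.exp (-(t - s) / ε) * b s := by
  set f : ℝ → ℝ := fun s => Real.exp (-(t - s) / ε) * b s with hf
  have hind : (fun v => (Iic t).indicator f (t - v)) = (Ici 0).indicator fun v => f (t - v) := by
    ext v
    by_cases hv : 0 ≤ v
    · rw [indicator_of_mem (by simpa using hv), indicator_of_mem (by simpa using hv)]
    · rw [indicator_of_notMem (by simpa using hv), indicator_of_notMem (by simpa using hv)]
  have hi : IntegrableOn (fun v => f (t - v)) (Ioi 0) := by
    have := ((integrable_indicator_iff measurableSet_Iic).2 h).comp_sub_left t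
    rw [hind, integrable_indicator_iff measurableSet_Ici] at this
    exact this.mono_set Ioi_subset_Ici_self
  have he : ∫ v in Ioi 0, f (t - v) = ∫ s in Iic t, f s := by
    have := integral_sub_left_eq_self ((Iic t).indicator f) volume t
    rwa [hind, integral_indicator measurableSet_Ici, integral_Ici_eq_integral_Ioi,
      integral_indicator measurableSet_Iic] at this
  have hfu : ∀ u, f (t - ε * u) = (ENNReal.ofReal (Real.exp (-u))).toReal • b (t - ε * u) := by
    intro u
    rw [ENNReal.toReal_ofReal (Real.exp_pos _).le, hf, smul_eq_mul]
    simp only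
    congr 2
    field_simp
    ring
  constructor
  · rw [stdExp, integrable_withDensity_iff_integrable_smul' (by fun_prop) (by simp)]
    simp only [← hfu]
    exact (integrableOn_Ioi_comp_mul_left_iff (fun v => f (t - v)) 0 hε).2 (by simpa using hi)
  · rw [stdExp, integral_withDensity_eq_integral_toReal_smul (by fun_prop) (by simp)]
    simp only [← hfu]
    rw [integral_comp_mul_left_Ioi (fun v => f (t - v)) 0 hε, mul_zero, he, smul_eq_mul, one_div]

lemma ofReal_expSmoothingError_pow_four_le {ε : ℝ} (hε : 0 < ε) {b : ℝ → ℝ} (hb : Continuous b)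
    {t : ℝ} (h : IntegrableOn (fun s => Real.exp (-(t - s) / ε) * |b s|) (Iic t)) :
    ENNReal.ofReal (expSmoothingError ε b t ^ 4)
      ≤ ∫⁻ u, ENNReal.ofReal ((b t - b (t - ε * u)) ^ 4) ∂stdExp := by
  obtain ⟨hi, he⟩ := integrable_comp_sub_mul_stdExp hε (integrableOn_exp_mul_of_abs hb h)
  have hE : expSmoothingError ε b t = ∫ u, (b t - b (t - ε * u)) ∂stdExp := by
    rw [integral_sub (integrable_const _) hi, he, expSmoothingError]
    simp
  have hpow : ∀ x : ℝ, ENNReal.ofReal (x ^ 4) = ‖x‖ₑ ^ 4 := fun x => by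
    rw [← enorm_pow, Real.enorm_of_nonneg (by positivity)]
  simp only [hpow]
  rw [hE]
  have hm : AEStronglyMeasurable (fun u => b t - b (t - ε * u)) stdExp := by fun_prop
  have h1 := eLpNorm_le_eLpNorm_of_exponent_le (p := 1) (q := ((4 : NNReal) : ENNReal))
    (by norm_num) hm
  rw [eLpNorm_one_eq_lintegral_enorm] at h1
  have h2 := eLpNorm_nnreal_pow_eq_lintegral (f := fun u => b t - b (t - ε * u)) (μ := stdExp)
    (p := 4) (by norm_num)
  simp only [NNReal.coe_ofNat, ENNReal.rpow_ofNat] at h2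
  rw [← h2]
  gcongr
  exact (enorm_integral_le_lintegral_enorm _).trans h1

variable {Ω : Type*} [MeasureSpace Ω] {H : ℝ} {B : ℝ → Ω → ℝ}

/-- Fractional Brownian motion has a jointly measurable indistinguishable version. -/
lemma IsTwoSidedFBM.exists_measurable_uncurry (hB : IsTwoSidedFBM H B) :
    ∃ B' : ℝ → Ω → ℝ, Measurable (Function.uncurry B') ∧ ∀ᵐ ω : Ω, ∀ t, B' t ω = B t ω := by
  set S := toMeasurable (ℙ : Measure Ω) {ω | ¬ Continuous fun t => B t ω} with hS
  have hSm : MeasurableSet S := measurableSet_toMeasurable _ _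
  have hS0 : (ℙ : Measure Ω) S = 0 := by rw [hS, measure_toMeasurable]; exact hB.cont
  refine ⟨fun t => Sᶜ.indicator (B t), ?_, ?_⟩
  · refine measurable_uncurry_of_continuous_of_measurable (fun ω => ?_)
      fun t => (hB.meas t).indicator hSm.compl
    by_cases hω : ω ∈ S
    · simpa [hω] using continuous_const
    · have : Continuous fun t => B t ω := by
        by_contra hc
        exact hω (subset_toMeasurable _ _ hc)
      simpa [hω] using this
  · filter_upwards [compl_mem_ae_iff.2 hS0] with ω hω t
    exact indicator_of_mem hω _

lemma IsTwoSidedFBM.lintegral_sub_pow_four (hB : IsTwoSidedFBM H B) (hH : 0 < H) (s t : ℝ) :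
    ∫⁻ ω, ENNReal.ofReal ((B t ω - B s ω) ^ 4) = ENNReal.ofReal (3 * |t - s| ^ (4 * H)) := by
  have hm : Measurable fun ω => B t ω - B s ω := (hB.meas t).sub (hB.meas s)
  have hl := hB.map_sub hH s t
  rw [← ofReal_integral_eq_lintegral_ofReal (integrable_pow_of_map_gaussianReal hm hl 4)
    (Eventually.of_forall fun ω => by positivity), integral_pow_four_of_map_gaussianReal hm hl,
    Real.coe_toNNReal _ (by positivity), ← Real.rpow_natCast, ← Real.rpow_mul (abs_nonneg _)]
  congr 3
  push_cast
  ring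

/-- The fourth power of the smoothing error is dominated by a random variable whose mean is of
order `ε ^ (4 * H)`. -/
lemma IsTwoSidedFBM.exists_integrable_expSmoothingError_pow_four_le (hB : IsTwoSidedFBM H B)
    [IsProbabilityMeasure (ℙ : Measure Ω)] (hH : 0 < H)
    (hInt : ∀ ε : ℝ, 0 < ε → ∀ᵐ ω : Ω, ∀ t : ℝ,
      IntegrableOn (fun s => Real.exp (-(t - s) / ε) * |B s ω|) (Iic t)) :
    ∃ K, 0 ≤ K ∧ ∀ ε : ℝ, 0 < ε → ∀ t : ℝ, ∃ M : Ω → ℝ, Integrable M ∧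
      (∀ᵐ ω, expSmoothingError ε (fun s => B s ω) t ^ 4 ≤ M ω) ∧
      ∫ ω, M ω ≤ K * ε ^ (4 * H) := by
  obtain ⟨B', hB'm, hB'⟩ := hB.exists_measurable_uncurry
  set c := ∫⁻ u, ENNReal.ofReal (|u| ^ (4 * H)) ∂stdExp with hc
  have hctop : c ≠ ⊤ := lintegral_rpow_stdExp_ne_top (by positivity)
  refine ⟨3 * c.toReal, by positivity, fun ε hε t => ?_⟩
  have hjm : Measurable fun p : Ω × ℝ =>
      ENNReal.ofReal ((B' t p.1 - B' (t - ε * p.2) p.1) ^ 4) := by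
    have h1 : Measurable fun p : Ω × ℝ => B' t p.1 :=
      hB'm.comp (measurable_const.prodMk measurable_fst)
    have h2 : Measurable fun p : Ω × ℝ => B' (t - ε * p.2) p.1 :=
      hB'm.comp ((measurable_const.sub (measurable_const.mul measurable_snd)).prodMk
        measurable_fst)
    exact ((h1.sub h2).pow_const 4).ennreal_ofReal
  set Q : Ω → ENNReal := fun ω =>
    ∫⁻ u, ENNReal.ofReal ((B' t ω - B' (t - ε * u) ω) ^ 4) ∂stdExp with hQ
  have hQm : Measurable Q := hjm.lintegral_prod_right'
  have hQint : ∫⁻ ω, Q ω = ENNReal.ofReal (3 * ε ^ (4 * H)) * c := by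
    rw [hQ, lintegral_lintegral_swap hjm.aemeasurable, hc,
      ← lintegral_const_mul _ (by fun_prop)]
    refine lintegral_congr fun u => ?_
    rw [← ENNReal.ofReal_mul (by positivity), mul_assoc, ← Real.mul_rpow hε.le (abs_nonneg _),
      ← abs_of_pos hε, ← abs_mul, abs_of_pos hε]
    have := hB.lintegral_sub_pow_four hH (t - ε * u) t
    rw [show t - (t - ε * u) = ε * u by ring] at this
    rw [← this]
    refine lintegral_congr_ae ?_
    filter_upwards [hB'] with ω hω
    rw [hω, hω]
  have hQtop : ∫⁻ ω, Q ω ≠ ⊤ := by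
    rw [hQint]; exact ENNReal.mul_ne_top ENNReal.ofReal_ne_top hctop
  refine ⟨fun ω => (Q ω).toReal, integrable_toReal_of_lintegral_ne_top hQm.aemeasurable hQtop,
    ?_, ?_⟩
  · filter_upwards [hB', hB.cont, hInt ε hε, ae_lt_top hQm hQtop] with ω h1 h2 h3 h4
    have := ofReal_expSmoothingError_pow_four_le hε h2 (h3 t)
    rw [← ENNReal.ofReal_le_iff_le_toReal h4.ne]
    refine this.trans_eq ?_
    simp only [hQ, h1]
  · rw [integral_toReal hQm.aemeasurable (ae_lt_top hQm hQtop), hQint, ENNReal.toReal_mul,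
      ENNReal.toReal_ofReal (by positivity)]
    exact le_of_eq (by ring)

end SmoothingErrorMoment

section Assembly

variable {Ω : Type*} [MeasureSpace Ω] {H : ℝ} {B : ℝ → Ω → ℝ}

/-- The estimator is a normalized sum of squares of whitened fractional Brownian increments,
perturbed by whitened increments of the smoothing error. -/
lemma sigmaHat2_eq {σ ε δ : ℝ} (hε : 0 < ε) {N : ℕ} {L : Matrix (Fin N) (Fin N) ℝ}
    (hL : (SigmaH H δ N)⁻¹ = Lᵀ * L) {ω : Ω}
    (hb : Continuous fun t => B t ω) (h0 : B 0 ω = 0)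
    (h : ∀ t, IntegrableOn (fun s => Real.exp (-(t - s) / ε) * |B s ω|) (Set.Iic t)) :
    sigmaHat2 H σ ε δ B N ω = σ ^ 2 * ((∑ i,
      ((L *ᵥ fun k : Fin N => B (((k : ℕ) + 1 : ℝ) * δ) ω - B ((k : ℕ) * δ) ω) i
        - (L *ᵥ fun k : Fin N => expSmoothingError ε (fun s => B s ω) (((k : ℕ) + 1 : ℝ) * δ)
          - expSmoothingError ε (fun s => B s ω) ((k : ℕ) * δ)) i) ^ 2) / N) := by
  set U : Fin N → ℝ := fun k => B (((k : ℕ) + 1 : ℝ) * δ) ω - B ((k : ℕ) * δ) ω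
  set Z : Fin N → ℝ := fun k => expSmoothingError ε (fun s => B s ω) (((k : ℕ) + 1 : ℝ) * δ)
          - expSmoothingError ε (fun s => B s ω) ((k : ℕ) * δ)
  have hV : incVec H σ ε δ B N ω = σ • (U - Z) := by
    ext k
    simp only [incVec, slowX_eq hε hb h0 h, U, Z, Pi.smul_apply, Pi.sub_apply, smul_eq_mul]
    ring
  rw [sigmaHat2, hV, hL, dotProduct_transpose_mul_mulVec, mulVec_smul, mulVec_sub]
  simp only [Pi.smul_apply, Pi.sub_apply, smul_eq_mul, mul_pow, ← Finset.mul_sum]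
  ring

/-- The whitened increments of fractional Brownian motion are a standard Gaussian vector. -/
lemma IsTwoSidedFBM.map_sum_whitened_increments (hB : IsTwoSidedFBM H B) {δ : ℝ} (hδ : 0 < δ)
    {N : ℕ} {L : Matrix (Fin N) (Fin N) ℝ} (hL : L * SigmaH H δ N * Lᵀ = 1) (c : Fin N → ℝ) :
    Measure.map (fun ω => ∑ i, c i *
      (L *ᵥ fun k : Fin N => B (((k : ℕ) + 1 : ℝ) * δ) ω - B ((k : ℕ) * δ) ω) i) ℙ
      = gaussianReal 0 (∑ i, c i ^ 2).toNNReal := by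
  have h1 : ∀ u : Fin N → ℝ, ∑ i, c i * (L *ᵥ u) i = ∑ k, (Lᵀ *ᵥ c) k * u k := fun u => by
    change c ⬝ᵥ (L *ᵥ u) = (Lᵀ *ᵥ c) ⬝ᵥ u
    rw [dotProduct_mulVec, mulVec_transpose]
  have h2 : (Lᵀ *ᵥ c) ⬝ᵥ (SigmaH H δ N *ᵥ (Lᵀ *ᵥ c)) = ∑ i, c i ^ 2 := by
    rw [mulVec_transpose, ← dotProduct_mulVec, ← mulVec_transpose, mulVec_mulVec, mulVec_mulVec,
      hL, one_mulVec]
    simp [dotProduct, sq]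
  simp only [h1]
  rw [hB.map_sum_increments hδ, h2]

/-- The fourth powers of the grid increments of the smoothing error are, on average over the grid,
dominated by a random variable whose mean is of order `ε ^ (4 * H)`. -/
lemma exists_integrable_sum_expSmoothingError_sub_pow_four_le {K ε : ℝ}
    (hK : ∀ t : ℝ, ∃ M : Ω → ℝ, Integrable M ∧
      (∀ᵐ ω, expSmoothingError ε (fun s => B s ω) t ^ 4 ≤ M ω) ∧ ∫ ω, M ω ≤ K * ε ^ (4 * H))
    (δ : ℝ) {N : ℕ} (hN : 0 < N) :
    ∃ Q : Ω → ℝ, Integrable Q ∧ ∫ ω, Q ω ≤ 16 * K * ε ^ (4 * H) ∧ ∀ᵐ ω,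
      (∑ k : Fin N, (expSmoothingError ε (fun s => B s ω) (((k : ℕ) + 1 : ℝ) * δ)
          - expSmoothingError ε (fun s => B s ω) ((k : ℕ) * δ)) ^ 4) / N ≤ Q ω := by
  choose M hMi hMle hMint using hK
  have hNpos : (0 : ℝ) < N := by exact_mod_cast hN
  have hi : ∀ k : Fin N, Integrable fun ω =>
      8 * (M (((k : ℕ) + 1 : ℝ) * δ) ω + M ((k : ℕ) * δ) ω) := fun k =>
    ((hMi _).add (hMi _)).const_mul 8
  refine ⟨fun ω => (∑ k : Fin N, 8 * (M (((k : ℕ) + 1 : ℝ) * δ) ω + M ((k : ℕ) * δ) ω)) / N,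
    (integrable_finsetSum _ fun k _ => hi k).div_const _, ?_, ?_⟩
  · rw [integral_div, integral_finsetSum _ fun k _ => hi k, div_le_iff₀ hNpos]
    calc _ ≤ ∑ k : Fin N, 16 * K * ε ^ (4 * H) := by
          refine Finset.sum_le_sum fun k _ => ?_
          rw [integral_const_mul, integral_add (hMi _) (hMi _)]
          linarith [hMint (((k : ℕ) + 1 : ℝ) * δ), hMint ((k : ℕ) * δ)]
      _ = _ := by simp; ring
  · have h1 : ∀ᵐ ω, ∀ k : Fin N,
        expSmoothingError ε (fun s => B s ω) (((k : ℕ) + 1 : ℝ) * δ) ^ 4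
          ≤ M (((k : ℕ) + 1 : ℝ) * δ) ω := ae_all_iff.2 fun k => hMle _
    have h2 : ∀ᵐ ω, ∀ k : Fin N, expSmoothingError ε (fun s => B s ω) ((k : ℕ) * δ) ^ 4
        ≤ M ((k : ℕ) * δ) ω := ae_all_iff.2 fun k => hMle _
    filter_upwards [h1, h2] with ω h1 h2
    gcongr with k
    have h4 : ∀ a b : ℝ, (a - b) ^ 4 ≤ 8 * (a ^ 4 + b ^ 4) := fun a b => by
      have e1 : (a - b) ^ 2 ≤ 2 * (a ^ 2 + b ^ 2) := by nlinarith [sq_nonneg (a + b)]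
      have e2 := pow_le_pow_left₀ (sq_nonneg (a - b)) e1 2
      nlinarith [sq_nonneg (a ^ 2 - b ^ 2)]
    linarith [h4 (expSmoothingError ε (fun s => B s ω) (((k : ℕ) + 1 : ℝ) * δ))
      (expSmoothingError ε (fun s => B s ω) ((k : ℕ) * δ)), h1 k, h2 k]

/-- Pointwise domination of the squared error of the estimator by a chi-squared fluctuation and
a smoothing error term. -/
lemma exists_integrable_sq_sigmaHat2_sub_le [IsProbabilityMeasure (ℙ : Measure Ω)]
    {σ ε δ m K : ℝ} (hH : H ∈ Set.Ioo (1 / 2 : ℝ) 1) (hB : IsTwoSidedFBM H B)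
    (hInt : ∀ᵐ ω : Ω, ∀ t : ℝ,
      IntegrableOn (fun s => Real.exp (-(t - s) / ε) * |B s ω|) (Set.Iic t))
    (hm : 0 < m) {N : ℕ}
    (hle : ∀ a : Fin N → ℝ, m * δ ^ (2 * H) * ∑ i, a i ^ 2 ≤ a ⬝ᵥ (SigmaH H δ N *ᵥ a))
    (hK : ∀ t : ℝ, ∃ M : Ω → ℝ, Integrable M ∧
      (∀ᵐ ω, expSmoothingError ε (fun s => B s ω) t ^ 4 ≤ M ω) ∧ ∫ ω, M ω ≤ K * ε ^ (4 * H))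
    (hε : 0 < ε) (hδ : 0 < δ) (hN : 0 < N) {l : ℝ} (hl : 0 < l) :
    ∃ A D : Ω → ℝ, Integrable A ∧ ∫ ω, A ω = (2 / N : ℝ) ∧ Integrable D ∧
      ∫ ω, D ω ≤ 16 * K / m ^ 2 * ((ε / δ) ^ (2 * H)) ^ 2 ∧
      ∀ᵐ ω, (sigmaHat2 H σ ε δ B N ω - σ ^ 2) ^ 2
        ≤ 3 * σ ^ 4 * ((1 + 4 * l) * A ω + 4 * l + (1 + 2 / l) * D ω) := by
  have hS := posDef_SigmaH hH.1.le hH.2 hδ N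
  obtain ⟨L, hL1, hL2⟩ := hS.exists_inv_eq_transpose_mul
  obtain ⟨Q, hQi, hQint, hQle⟩ := exists_integrable_sum_expSmoothingError_sub_pow_four_le hK δ hN
  have hNpos : (0 : ℝ) < N := by exact_mod_cast hN
  have hmδ : 0 < m * δ ^ (2 * H) := by positivity
  have hWm : ∀ i, Measurable fun ω =>
      (L *ᵥ fun k : Fin N => B (((k : ℕ) + 1 : ℝ) * δ) ω - B ((k : ℕ) * δ) ω) i := fun i => by
    have := hB.meas
    simp only [mulVec, dotProduct]
    fun_prop
  obtain ⟨hAi, hAint⟩ := integral_sq_normalized_sum_sq hN _ hWm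
    (hB.map_sum_whitened_increments hδ hL2)
  refine ⟨_, fun ω => Q ω / (m * δ ^ (2 * H)) ^ 2, hAi, hAint, hQi.div_const _, ?_, ?_⟩
  · rw [integral_div, div_le_iff₀ (by positivity)]
    refine hQint.trans_eq ?_
    rw [Real.div_rpow hε.le hδ.le, show 4 * H = 2 * H * (2 : ℕ) by push_cast; ring,
      Real.rpow_mul_natCast hε.le]
    have : δ ^ (2 * H) ≠ 0 := by positivity
    field_simp
  · filter_upwards [hB.cont, hB.zero, hInt, hQle] with ω h1 h2 h3 h4
    rw [sigmaHat2_eq hε hL1 h1 h2 h3]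
    set U : Fin N → ℝ := fun k => B (((k : ℕ) + 1 : ℝ) * δ) ω - B ((k : ℕ) * δ) ω
    set Z : Fin N → ℝ := fun k => expSmoothingError ε (fun s => B s ω) (((k : ℕ) + 1 : ℝ) * δ)
            - expSmoothingError ε (fun s => B s ω) ((k : ℕ) * δ)
    have hR : ((∑ i, (L *ᵥ Z) i ^ 2) / N) ^ 2 ≤ Q ω / (m * δ ^ (2 * H)) ^ 2 := by
      have e1 := dotProduct_inv_mulVec_le hmδ hS hle Z
      rw [hL1, dotProduct_transpose_mul_mulVec] at e1
      calc ((∑ i, (L *ᵥ Z) i ^ 2) / N) ^ 2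
          ≤ ((∑ i, Z i ^ 2) / (m * δ ^ (2 * H)) / N) ^ 2 := by gcongr
        _ = ((∑ i, Z i ^ 2) / N) ^ 2 / (m * δ ^ (2 * H)) ^ 2 := by ring
        _ ≤ Q ω / (m * δ ^ (2 * H)) ^ 2 := by
          gcongr
          exact (sq_normalized_sum_sq_le hN Z).trans h4
    calc _ = σ ^ 4 * ((∑ i, ((L *ᵥ U) i - (L *ᵥ Z) i) ^ 2) / N - 1) ^ 2 := by ring
      _ ≤ σ ^ 4 * (3 * ((1 + 4 * l) * ((∑ i, (L *ᵥ U) i ^ 2) / N - 1) ^ 2 + 4 * l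
          + (1 + 2 / l) * ((∑ i, (L *ᵥ Z) i ^ 2) / N) ^ 2)) := by
        gcongr
        exact sq_normalized_sum_sq_sub_le hN _ _ hl
      _ ≤ σ ^ 4 * (3 * ((1 + 4 * l) * ((∑ i, (L *ᵥ U) i ^ 2) / N - 1) ^ 2 + 4 * l
          + (1 + 2 / l) * (Q ω / (m * δ ^ (2 * H)) ^ 2))) := by gcongr
      _ = _ := by ring

end Assembly

/-- Quantitative L² error bound for the MLE-type estimator in the physical fractional
Brownian motion model, case `H > 1/2`:
`‖σ̂²_{ε,δ} − σ²‖_{L²} ≤ C((ε/δ)^{2H} + (ε/δ)^H + δ^{1/2})` with `δ = T/N`. -/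
theorem sigmaHat2_L2_bound_of_half_lt
    {Ω : Type*} [MeasureSpace Ω] [IsProbabilityMeasure (ℙ : Measure Ω)]
    (H σ T : ℝ) (hH : H ∈ Set.Ioo (1 / 2 : ℝ) 1) (hσ : 0 < σ) (hT : 0 < T)
    (B : ℝ → Ω → ℝ) (hB : IsTwoSidedFBM H B)
    (hInt : ∀ ε : ℝ, 0 < ε → ∀ᵐ ω : Ω, ∀ t : ℝ,
      IntegrableOn (fun s => Real.exp (-(t - s) / ε) * |B s ω|) (Set.Iic t)) :
    ∃ C > 0, ∀ ε : ℝ, 0 < ε → ∀ N : ℕ, 0 < N →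
      Real.sqrt (∫ ω, (sigmaHat2 H σ ε (T / N) B N ω - σ ^ 2) ^ 2)
        ≤ C * ((ε / (T / N)) ^ (2 * H) + (ε / (T / N)) ^ H + Real.sqrt (T / N)) := by
  obtain ⟨m, hm, hmle⟩ := exists_le_dotProduct_SigmaH hH.1.le hH.2
  have hH0 : 0 < H := by linarith [hH.1]
  obtain ⟨K, hK0, hK⟩ := hB.exists_integrable_expSmoothingError_pow_four_le hH0 hInt
  set K' := 16 * K / m ^ 2 with hK'
  have hK'0 : 0 ≤ K' := by positivity
  refine ⟨Real.sqrt (3 * σ ^ 4 * (2 / T + 12 + 3 * K')), by positivity, fun ε hε N hN => ?_⟩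
  have hNpos : (0 : ℝ) < N := by exact_mod_cast hN
  have hδ : 0 < T / N := by positivity
  set δ := T / N with hδdef
  have hr0 : 0 < (ε / δ) ^ H := by positivity
  have hrl : (ε / δ) ^ (2 * H) = ((ε / δ) ^ H) ^ 2 := by
    rw [mul_comm, Real.rpow_mul (by positivity), Real.rpow_ofNat]
  have hl0 : 0 < (ε / δ) ^ (2 * H) := by positivity
  obtain ⟨A, D, hA, hAle, hD, hDle, hle⟩ :=
    exists_integrable_sq_sigmaHat2_sub_le (σ := σ) hH hB (hInt ε hε) hm (hmle δ hδ N) (hK ε hε)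
      hε hδ hN hl0
  rw [mul_comm (Real.sqrt _), ← Real.sqrt_sq (by positivity :
    0 ≤ (ε / δ) ^ (2 * H) + (ε / δ) ^ H + Real.sqrt δ), ← Real.sqrt_mul (by positivity)]
  refine Real.sqrt_le_sqrt ?_
  set l := (ε / δ) ^ (2 * H) with hl
  set r := (ε / δ) ^ H with hr
  have hA' : Integrable fun ω => (1 + 4 * l) * A ω + 4 * l :=
    (hA.const_mul _).add (integrable_const _)
  have hint : Integrable fun ω => 3 * σ ^ 4 *
      ((1 + 4 * l) * A ω + 4 * l + (1 + 2 / l) * D ω) :=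
    (hA'.add (hD.const_mul _)).const_mul _
  refine (integral_mono_of_nonneg (Eventually.of_forall fun ω => sq_nonneg _) hint hle).trans ?_
  rw [integral_const_mul, integral_add hA' (hD.const_mul _),
    integral_add (hA.const_mul _) (integrable_const _), integral_const, integral_const_mul,
    integral_const_mul, hAle]
  simp only [probReal_univ, smul_eq_mul, one_mul]
  have hN1 : (2 / N : ℝ) ≤ 2 := by
    rw [div_le_iff₀ hNpos]
    have : (1 : ℝ) ≤ N := by exact_mod_cast hN
    linarith
  have hNδ : (2 / N : ℝ) = 2 / T * δ := by rw [hδdef]; field_simp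
  have h1 : (1 + 4 * l) * (2 / N : ℝ) ≤ 2 / T * δ + 8 * l := by
    rw [add_mul, one_mul, ← hNδ]
    nlinarith
  have h2 : (1 + 2 / l) * ∫ ω, D ω ≤ K' * l ^ 2 + 2 * K' * l := by
    refine (mul_le_mul_of_nonneg_left hDle (by positivity)).trans_eq ?_
    rw [hK']
    field_simp
  have hs : Real.sqrt δ ^ 2 = δ := Real.sq_sqrt hδ.le
  have hs0 := Real.sqrt_nonneg δ
  have h3 : l ^ 2 + l + δ ≤ (l + r + Real.sqrt δ) ^ 2 := by
    have := mul_nonneg hl0.le hr0.le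
    have := mul_nonneg hl0.le hs0
    have := mul_nonneg hr0.le hs0
    nlinarith [hrl]
  calc _ ≤ 3 * σ ^ 4 * ((2 / T * δ + 8 * l) + 4 * l + (K' * l ^ 2 + 2 * K' * l)) := by gcongr
    _ ≤ 3 * σ ^ 4 * ((2 / T + 12 + 3 * K') * (l ^ 2 + l + δ)) := by
      gcongr
      have : 0 ≤ 2 / T := by positivity
      have := mul_nonneg this (sq_nonneg l)
      have := mul_nonneg ‹0 ≤ 2 / T› hl0.le
      have := mul_nonneg hK'0 (sq_nonneg l)
      have := mul_nonneg hK'0 hl0.le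
      have := mul_nonneg hK'0 hδ.le
      nlinarith [sq_nonneg l]
    _ ≤ 3 * σ ^ 4 * ((2 / T + 12 + 3 * K') * (l + r + Real.sqrt δ) ^ 2) := by gcongr
    _ = _ := by ring
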